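/- arXiv:1205.2535 — 2 statements merged into one kernel-verified Lean document; each statement's English description precedes it below -/
import Mathlib

section
/- Let F be a set of finite simple graphs none of which is complete, and let G be a finite simple graph that is locally F-decomposable. Then every LexBFS ordering (v₁, …, vₙ) of G is an F-elimination ordering, i.e., for every i, the neighborhood of vᵢ inside the induced subgraph G[{v₁, …, vᵢ}] induces an F-free graph. -/
open SimpleGraph

/-- A set `s` of vertices of `G` induces a copy of some member of the family `F`
(members of `F` are finite graphs given on `Fin n`). -/
def inducesMemberOf {V : Type*} (G : SimpleGraph V)
    (F : Set ((n : ℕ) × SimpleGraph (Fin n))) (s : Set V) : Prop :=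
  ∃ H ∈ F, Nonempty (G.induce s ≃g H.2)

/-- `G` is locally `F`-decomposable: for every vertex `v`, every induced copy of a
member of `F` inside `N(v)`, and every connected component `C` of `G − N[v]`, some
vertex `y` of the copy has a non-neighbor in the copy and no neighbor in `C`. -/
def LocallyDecomposable {V : Type*} (G : SimpleGraph V)
    (F : Set ((n : ℕ) × SimpleGraph (Fin n))) : Prop :=
  ∀ v : V, ∀ s : Set V, s ⊆ G.neighborSet v → inducesMemberOf G F s →
    ∀ C : (G.induce {w : V | ¬ (w = v ∨ G.Adj v w)}).ConnectedComponent,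
      ∃ y ∈ s, (∃ y' ∈ s, y' ≠ y ∧ ¬ G.Adj y y') ∧
        ∀ w : {w : V | ¬ (w = v ∨ G.Adj v w)},
          (G.induce {w : V | ¬ (w = v ∨ G.Adj v w)}).connectedComponentMk w = C →
          ¬ G.Adj y ↑w

/-- if `F` is a set of non-complete graphs and `G` is locally
`F`-decomposable, then every LexBFS ordering of `G` is an `F`-elimination ordering:
for every vertex `v`, the set of neighbors of `v` preceding `v` induces an
`F`-free graph. -/
theorem stmt_3 {V : Type*} [Fintype V] [LinearOrder V] (G : SimpleGraph V)
    (F : Set ((n : ℕ) × SimpleGraph (Fin n)))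
    (hF : ∀ H ∈ F, H.2 ≠ (⊤ : SimpleGraph (Fin H.1)))
    (hG : LocallyDecomposable G F)
    (hlex : ∀ a b c : V, c < b → b < a → G.Adj c a → ¬ G.Adj c b →
      ∃ d : V, d < c ∧ G.Adj d b ∧ ¬ G.Adj d a) :
    ∀ v : V, ∀ s : Set V, s ⊆ {w : V | w < v ∧ G.Adj v w} →
      ¬ inducesMemberOf G F s := by
  classical
  intro v s hs hind
  have hsN : s ⊆ G.neighborSet v := fun w hw => (hs hw).2
  -- a nonadjacent pair in s
  have hpair : ∃ x ∈ s, ∃ y ∈ s, x < y ∧ ¬ G.Adj x y := by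
    by_contra hcon
    push Not at hcon
    obtain ⟨H, hH, ⟨φ⟩⟩ := hind
    apply hF H hH
    ext i j
    rw [SimpleGraph.top_adj]
    refine ⟨fun h => h.ne, fun hne => ?_⟩
    have h1 : φ.symm i ≠ φ.symm j := fun h => hne (φ.symm.injective h)
    have h2 : (G.induce s).Adj (φ.symm i) (φ.symm j) := by
      rw [SimpleGraph.induce_adj]
      have h3 : (φ.symm i : V) ≠ (φ.symm j : V) := fun h => h1 (Subtype.ext h)
      rcases lt_or_gt_of_ne h3 with h | h
      · exact hcon _ (φ.symm i).2 _ (φ.symm j).2 h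
      · exact (hcon _ (φ.symm j).2 _ (φ.symm i).2 h).symm
    exact φ.symm.map_adj_iff.1 h2
  -- nonneighbours of v before v
  have hU : ∃ d, d < v ∧ ¬ G.Adj d v := by
    obtain ⟨x, hx, y, hy, hxy, hn⟩ := hpair
    obtain ⟨d, hd, -, h2⟩ := hlex v y x hxy (hs hy).1 (hs hx).2.symm hn
    exact ⟨d, hd.trans (hs hx).1, h2⟩
  let Q : V → Prop := fun b => (b < v ∧ ¬ G.Adj b v) ∧
    ∀ u, u < b → ¬ G.Adj u v → ∀ w, b ≤ w → w < v → ¬ G.Adj u w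
  have hQ0 : ∃ b, Q b := by
    obtain ⟨b, hb, hmin⟩ := Set.Finite.exists_minimal (Set.toFinite {d | d < v ∧ ¬ G.Adj d v}) hU
    refine ⟨b, hb, fun u hu hnu => ?_⟩
    exact absurd (hmin ⟨hu.trans hb.1, hnu⟩ hu.le) (not_le.2 hu)
  obtain ⟨b, ⟨⟨hbv, hbn⟩, hb⟩, hmax⟩ := Set.Finite.exists_maximal (Set.toFinite {d | Q d}) hQ0
  let A : Set V := {w : V | ¬ (w = v ∨ G.Adj v w)}
  have hA : ∀ w, w < v → ¬ G.Adj w v → w ∈ A := fun w h1 h2 h =>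
    h.elim (fun h => h1.ne h) (fun h => h2 h.symm)
  let C := (G.induce A).connectedComponentMk ⟨b, hA b hbv hbn⟩
  let R : V → Prop := fun w => ∃ h : w ∈ A, (G.induce A).connectedComponentMk ⟨w, h⟩ = C
  have hR : ∀ u w, R u → w ∈ A → G.Adj u w → R w := by
    rintro u w ⟨hu, hc⟩ hw huw
    refine ⟨hw, ?_⟩
    rw [← hc]
    apply SimpleGraph.ConnectedComponent.sound
    apply SimpleGraph.Adj.reachable
    exact huw.symm
  have hRb : R b := ⟨hA b hbv hbn, rfl⟩
  -- every later nonneighbour of v lies in C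
  have hC : ∀ d, b ≤ d → d < v → ¬ G.Adj d v → R d := by
    by_contra hcon
    push Not at hcon
    obtain ⟨e, ⟨hbe, hev, hen, heR⟩, hmin⟩ := Set.Finite.exists_minimal
      (Set.toFinite {d | b ≤ d ∧ d < v ∧ ¬ G.Adj d v ∧ ¬ R d}) hcon
    have hbe' : b < e := lt_of_le_of_ne hbe (fun h => heR (h ▸ hRb))
    have he : ∀ u, u < e → ¬ G.Adj u v → ¬ G.Adj u e := by
      intro u hu hun hue
      rcases lt_or_ge u b with h | h
      · exact hb u h hun e hbe hev hue
      · have : R u := by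
          by_contra hRu
          exact absurd (hmin ⟨h, hu.trans hev, hun, hRu⟩ hu.le) (not_le.2 hu)
        exact heR (hR u e this (hA e hev hen) hue)
    have hQe : Q e := by
      refine ⟨⟨hev, hen⟩, ?_⟩
      by_contra hcon2
      push Not at hcon2
      obtain ⟨u, ⟨hue, hun, w, hew, hwv, huw⟩, hmin2⟩ := Set.Finite.exists_minimal
        (Set.toFinite {u | u < e ∧ ¬ G.Adj u v ∧ ∃ w, e ≤ w ∧ w < v ∧ G.Adj u w}) hcon2
      have hew' : e < w := lt_of_le_of_ne hew (fun h => he u hue hun (h ▸ huw))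
      obtain ⟨d, hdu, hde, hdw⟩ := hlex w e u hue hew' huw (he u hue hun)
      have hdv : G.Adj d v := by
        by_contra h
        exact he d (hdu.trans hue) h hde
      obtain ⟨d', hd', hdw', hdv'⟩ := hlex v w d ((hdu.trans hue).trans hew') hwv hdv hdw
      exact absurd (hmin2 ⟨(hd'.trans hdu).trans hue, hdv', w, hew, hwv, hdw'⟩
        (hd'.trans hdu).le) (not_le.2 (hd'.trans hdu))
    exact absurd (hmax hQe hbe) (not_le.2 hbe')
  obtain ⟨y, hy, ⟨y', hy', hne, hnadj⟩, hyC⟩ := hG v s hsN hind C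
  have hyR : ∀ w, R w → ¬ G.Adj y w := fun w hw => hyC ⟨w, hw.1⟩ hw.2
  have hyv := (hs hy).1
  have hyv' := (hs hy').1
  have hya := (hs hy).2
  have hya' := (hs hy').2
  have hfar : ∀ d w, b ≤ w → w < v → d < v → ¬ G.Adj d v → G.Adj d w → R d := by
    intro d w hw hwv hd hdn hdw
    rcases lt_or_ge d b with h | h
    · exact absurd hdw (hb d h hdn w hw hwv)
    · exact hC d h hd hdn
  rcases lt_or_ge y b with hyb | hyb
  · apply hyR b hRb
    by_contra h
    obtain ⟨d, hd, hdb, hdv⟩ := hlex v b y hyb hbv hya.symm h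
    exact hb d (hd.trans hyb) hdv b le_rfl hbv hdb
  rcases lt_or_gt_of_ne hne with hlt | hlt
  · obtain ⟨d, hd, hdy, hdv⟩ := hlex v y y' hlt hyv hya'.symm (fun h => hnadj h.symm)
    exact hyR d (hfar d y hyb hyv (hd.trans hyv') hdv hdy) hdy.symm
  · have hex : ∃ d, d < y ∧ G.Adj d y' ∧ ¬ G.Adj d v := hlex v y' y hlt hyv' hya.symm hnadj
    obtain ⟨d, ⟨hd, hdy', hdv⟩, hmin⟩ := Set.Finite.exists_minimal
      (Set.toFinite {d | d < y ∧ G.Adj d y' ∧ ¬ G.Adj d v}) hex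
    have hdR : R d := hfar d y' (hyb.trans hlt.le) hyv' (hd.trans hyv) hdv hdy'
    have hdy : ¬ G.Adj d y := fun h => hyR d hdR h.symm
    obtain ⟨d', hd', hd'y, hd'y'⟩ := hlex y' y d hd hlt hdy' hdy
    by_cases hd'v : G.Adj d' v
    · obtain ⟨f, hf, hfy', hfv⟩ :=
        hlex v y' d' ((hd'.trans hd).trans hlt) hyv' hd'v hd'y'
      exact absurd (hmin ⟨(hf.trans hd').trans hd, hfy', hfv⟩ (hf.trans hd').le)
        (not_le.2 (hf.trans hd'))
    · exact hyR d' (hfar d' y hyb hyv ((hd'.trans hd).trans hyv) hd'v hd'y) hd'y.symm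
end

section
/- A finite simple graph G is locally {P₃}-decomposable if and only if G contains no 3-wheel, where P₃ is the path on three vertices. (A 3-wheel is a wheel — a hole H together with a vertex v having at least three neighbors on H — such that some three consecutive vertices of H are all adjacent to v.) -/
open SimpleGraph

/-- `G` contains a 3-wheel: there is a hole (an induced cycle of length at least 4,
given by a graph embedding of `cycleGraph n` into `G`) and a vertex `v` off the hole
adjacent to three consecutive vertices of the hole. -/
def ContainsThreeWheel {V : Type*} (G : SimpleGraph V) : Prop :=
  ∃ (n : ℕ), 4 ≤ n ∧ ∃ (e : SimpleGraph.cycleGraph n ↪g G) (v : V),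
    (∀ i : Fin n, v ≠ e i) ∧
    ∃ i j k : Fin n, (SimpleGraph.cycleGraph n).Adj i j ∧
      (SimpleGraph.cycleGraph n).Adj j k ∧ i ≠ k ∧
      G.Adj v (e i) ∧ G.Adj v (e j) ∧ G.Adj v (e k)

/-- Cyclic adjacency on natural numbers below `n`. -/
def CycAdj (n s t : ℕ) : Prop :=
  s + 1 = t ∨ t + 1 = s ∨ (s = 0 ∧ t + 1 = n) ∨ (t = 0 ∧ s + 1 = n)

lemma cycleGraph_adj_iff_cycAdj (n : ℕ) (hn : 4 ≤ n) (i j : Fin n) :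
    (SimpleGraph.cycleGraph n).Adj i j ↔ CycAdj n i.val j.val := by
  obtain ⟨m, rfl⟩ : ∃ m, n = m + 2 := ⟨n - 2, by omega⟩
  rw [SimpleGraph.cycleGraph_adj']
  have key : ∀ a b : Fin (m+2), (a - b).val = 1 ↔
      (b.val + 1 = a.val ∨ (a.val = 0 ∧ b.val + 1 = m + 2)) := by
    intro a b
    have ha := a.isLt
    have hb := b.isLt
    rw [Fin.sub_def]
    simp only
    by_cases h : b.val ≤ a.val
    · have : m + 2 - b.val + a.val = (a.val - b.val) + (m + 2) := by omega
      rw [this, Nat.add_mod_right, Nat.mod_eq_of_lt (by omega)]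
      omega
    · rw [Nat.mod_eq_of_lt (by omega)]
      omega
  rw [key, key]
  unfold CycAdj
  omega

lemma threeWheel_iff {V : Type*} (G : SimpleGraph V) :
    ContainsThreeWheel G ↔ ∃ (n : ℕ) (f : ℕ → V) (c : V), 4 ≤ n ∧
      (∀ s t, s < n → t < n → f s = f t → s = t) ∧
      (∀ s t, s < n → t < n → (G.Adj (f s) (f t) ↔ CycAdj n s t)) ∧
      (∀ s, s < n → c ≠ f s) ∧ G.Adj c (f 0) ∧ G.Adj c (f 1) ∧ G.Adj c (f (n - 1)) := by
  constructor
  · rintro ⟨n, hn, e, c, hc, i, j, k, hij, hjk, hik, hi, hj, hk⟩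
    have hj' := j.isLt
    have hmod : ∀ t, t < n → (j.val + t) % n = if j.val + t < n then j.val + t else j.val + t - n := by
      intro t ht
      split_ifs with h
      · exact Nat.mod_eq_of_lt h
      · rw [Nat.mod_eq_sub_mod (by omega), Nat.mod_eq_of_lt (by omega)]
    rw [cycleGraph_adj_iff_cycAdj n hn] at hij hjk
    have hik' : i.val ≠ k.val := fun h => hik (Fin.ext h)
    have hil := i.isLt
    have hkl := k.isLt
    have h0 : (j.val + 0) % n = j.val := by rw [hmod 0 (by omega)]; split_ifs <;> omega
    have h1 := hmod 1 (by omega)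
    have h2 := hmod (n - 1) (by omega)
    have hlt : ∀ t, (j.val + t) % n < n := fun t => Nat.mod_lt _ (by omega)
    refine ⟨n, fun t => e ⟨(j.val + t) % n, hlt t⟩, c, hn, ?_, ?_, fun s _ => hc _, ?_, ?_⟩
    · intro s t hs ht h
      have := congrArg Fin.val (e.injective h)
      simp only [hmod s hs, hmod t ht] at this
      split_ifs at this <;> omega
    · intro s t hs ht
      rw [e.map_adj_iff, cycleGraph_adj_iff_cycAdj n hn]
      simp only [hmod s hs, hmod t ht]
      unfold CycAdj
      split_ifs <;> omega
    · have : (⟨(j.val + 0) % n, hlt 0⟩ : Fin n) = j := Fin.ext h0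
      simp only [this]; exact hj
    · unfold CycAdj at hij hjk
      have : ((j.val + 1) % n = i.val ∧ (j.val + (n-1)) % n = k.val) ∨
          ((j.val + 1) % n = k.val ∧ (j.val + (n-1)) % n = i.val) := by
        rw [h1, h2]
        split_ifs <;> omega
      rcases this with ⟨ha, hb⟩ | ⟨ha, hb⟩
      · simp only [ha, hb]; exact ⟨hi, hk⟩
      · simp only [ha, hb]; exact ⟨hk, hi⟩
  · rintro ⟨n, f, c, hn, hinj, hadj, hc, h0, h1, h2⟩
    refine ⟨n, hn, ⟨⟨fun i => f i.val, fun a b h => Fin.ext (hinj _ _ a.isLt b.isLt h)⟩, ?_⟩, c,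
      fun i => hc _ i.isLt, ⟨1, by omega⟩, ⟨0, by omega⟩, ⟨n - 1, by omega⟩, ?_, ?_, ?_, h1, h0, h2⟩
    · intro a b
      rw [cycleGraph_adj_iff_cycAdj n hn]
      exact hadj _ _ a.isLt b.isLt
    · rw [cycleGraph_adj_iff_cycAdj n hn]; simp [CycAdj]
    · rw [cycleGraph_adj_iff_cycAdj n hn]; change CycAdj n 0 (n - 1); unfold CycAdj; omega
    · intro h
      have := congrArg Fin.val h
      simp only at this
      omega

/-- A shortest path is induced. -/
lemma exists_induced_path {W : Type*} (H : SimpleGraph W) (x z : W) (h : H.Reachable x z) :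
    ∃ (m : ℕ) (p : ℕ → W), p 0 = x ∧ p m = z ∧
      (∀ s t, s ≤ m → t ≤ m → p s = p t → s = t) ∧
      (∀ s t, s ≤ m → t ≤ m → (H.Adj (p s) (p t) ↔ (s + 1 = t ∨ t + 1 = s))) := by
  obtain ⟨w, hw⟩ := h.exists_walk_length_eq_dist
  have hd : ∀ s, s ≤ w.length → H.dist x (w.getVert s) = s := by
    intro s hs
    apply le_antisymm
    · have := SimpleGraph.dist_le (w.take s)
      rwa [SimpleGraph.Walk.take_length, min_eq_left hs] at this
    · by_contra hlt
      push Not at hlt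
      obtain ⟨q, hq⟩ := (w.take s).reachable.exists_walk_length_eq_dist
      have h3 := SimpleGraph.dist_le (q.append (w.drop s))
      rw [SimpleGraph.Walk.length_append, SimpleGraph.Walk.drop_length] at h3
      omega
  refine ⟨w.length, w.getVert, by simp, by simp, ?_, ?_⟩
  · intro s t hs ht h
    rw [← hd s hs, ← hd t ht, h]
  · intro s t hs ht
    have step : ∀ a b, a ≤ w.length → b ≤ w.length → H.Adj (w.getVert a) (w.getVert b) →
        b ≤ a + 1 := by
      intro a b ha hb hab
      obtain ⟨q, hq⟩ := (w.take a).reachable.exists_walk_length_eq_dist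
      have h3 := SimpleGraph.dist_le (q.concat hab)
      rw [SimpleGraph.Walk.length_concat, hq, hd a ha, hd b hb] at h3
      exact h3
    constructor
    · intro h
      have h1 := step s t hs ht h
      have h2 := step t s ht hs h.symm
      have h3 : s ≠ t := by rintro rfl; exact H.loopless.irrefl _ h
      omega
    · rintro (rfl | rfl)
      · exact w.adj_getVert_succ (by omega)
      · exact (w.adj_getVert_succ (by omega)).symm

/-- `G` is locally `{P₃}`-decomposable iff `G` contains no 3-wheel.
Local `{P₃}`-decomposability is stated explicitly: for every vertex `v`, every
induced path `x–y–z` in `N(v)`, and every connected component `C` of `G − N[v]`,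
at least one of `x`, `z` has no neighbor in `C`. -/
theorem stmt_7 {V : Type*} [Fintype V] (G : SimpleGraph V) :
    (∀ v x y z : V, G.Adj v x → G.Adj v y → G.Adj v z →
      G.Adj x y → G.Adj y z → x ≠ z → ¬ G.Adj x z →
      ∀ C : (G.induce {w : V | ¬ (w = v ∨ G.Adj v w)}).ConnectedComponent,
        (∀ w : {w : V | ¬ (w = v ∨ G.Adj v w)},
          (G.induce {w : V | ¬ (w = v ∨ G.Adj v w)}).connectedComponentMk w = C →
          ¬ G.Adj x ↑w) ∨
        (∀ w : {w : V | ¬ (w = v ∨ G.Adj v w)},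
          (G.induce {w : V | ¬ (w = v ∨ G.Adj v w)}).connectedComponentMk w = C →
          ¬ G.Adj z ↑w)) ↔
    ¬ ContainsThreeWheel G := by
  rw [threeWheel_iff]
  constructor
  · rintro hloc ⟨n, f, c, hn, hinj, hadj, hc, h0, h1, h2⟩
    have hmem : ∀ t, 2 ≤ t → t + 2 ≤ n → ¬ (f t = f 0 ∨ G.Adj (f 0) (f t)) := by
      rintro t ht1 ht2 (h | h)
      · have := hinj _ _ (by omega) (by omega) h
        omega
      · rw [hadj _ _ (by omega) (by omega)] at h
        unfold CycAdj at h
        omega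
    have hreach : ∀ t, (ht1 : 2 ≤ t) → (ht2 : t + 2 ≤ n) →
        (G.induce {w : V | ¬ (w = f 0 ∨ G.Adj (f 0) w)}).Reachable
          ⟨f t, hmem t ht1 ht2⟩ ⟨f 2, hmem 2 le_rfl (by omega)⟩ := by
      intro t ht1
      induction t, ht1 using Nat.le_induction with
      | base => intro _; exact SimpleGraph.Reachable.refl _
      | succ t ht ih =>
        intro ht2
        refine SimpleGraph.Reachable.trans (SimpleGraph.Adj.reachable ?_) (ih (by omega))
        rw [SimpleGraph.induce_adj]
        exact (hadj _ _ (by omega) (by omega)).2 (by unfold CycAdj; omega)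
    rcases hloc (f 0) (f 1) c (f (n - 1))
      ((hadj _ _ (by omega) (by omega)).2 (by unfold CycAdj; omega)) h0.symm
      ((hadj _ _ (by omega) (by omega)).2 (by unfold CycAdj; omega)) h1.symm h2
      (fun h => by have := hinj _ _ (by omega) (by omega) h; omega)
      (fun h => by
        rw [hadj _ _ (by omega) (by omega)] at h
        unfold CycAdj at h
        omega)
      (SimpleGraph.connectedComponentMk _ ⟨f 2, hmem 2 le_rfl (by omega)⟩) with h | h
    · exact h ⟨f 2, hmem 2 le_rfl (by omega)⟩ rfl
        ((hadj _ _ (by omega) (by omega)).2 (by unfold CycAdj; omega))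
    · exact h ⟨f (n - 2), hmem (n - 2) (by omega) (by omega)⟩
        (SimpleGraph.ConnectedComponent.eq.2 (hreach _ (by omega) (by omega)))
        ((hadj _ _ (by omega) (by omega)).2 (by unfold CycAdj; omega))
  · intro hno v x y z hvx hvy hvz hxy hyz hxz hnxz C
    by_contra hcon
    push Not at hcon
    obtain ⟨⟨a, haC, hxa⟩, ⟨b, hbC, hzb⟩⟩ := hcon
    apply hno
    have hab := SimpleGraph.ConnectedComponent.eq.1 (haC.trans hbC.symm)
    set S : Set V := {w : V | ¬ (w = v ∨ G.Adj v w)} with hS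
    let T : Set V := {w : V | w = x ∨ w = z ∨ w ∈ S}
    let x' : T := ⟨x, Or.inl rfl⟩
    let z' : T := ⟨z, Or.inr (Or.inl rfl)⟩
    have hST : S ⊆ T := fun w hw => Or.inr (Or.inr hw)
    have hab' := hab.map (SimpleGraph.induceHomOfLE G hST).toHom
    have hr : (G.induce T).Reachable x' z' := by
      refine SimpleGraph.Reachable.trans (SimpleGraph.Adj.reachable ?_)
        (hab'.trans (SimpleGraph.Adj.reachable ?_))
      · exact hxa
      · exact hzb.symm
    obtain ⟨m, p, hp0, hpm, pinj, padj⟩ := exists_induced_path _ _ _ hr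
    have hm0 : m ≠ 0 := by
      rintro rfl
      exact hxz (congrArg Subtype.val (hp0.symm.trans hpm))
    have hm1 : m ≠ 1 := by
      rintro rfl
      have := (padj 0 1 (by omega) (by omega)).2 (by omega)
      rw [hp0, hpm] at this
      exact hnxz this
    have hvT : ∀ s, (p s).val ≠ v := by
      intro s h
      rcases (p s).2 with h1 | h1 | h1
      · exact hvx.ne (h.symm.trans h1)
      · exact hvz.ne (h.symm.trans h1)
      · exact h1 (Or.inl h)
    have hvadj : ∀ s, s ≤ m → (G.Adj v (p s) ↔ s = 0 ∨ s = m) := by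
      intro s hs
      constructor
      · intro h
        rcases (p s).2 with h1 | h1 | h1
        · left; exact pinj _ _ hs (by omega) ((Subtype.ext h1 : p s = x').trans hp0.symm)
        · right; exact pinj _ _ hs (by omega) ((Subtype.ext h1 : p s = z').trans hpm.symm)
        · exact absurd (Or.inr h) h1
      · rintro (rfl | rfl)
        · rw [hp0]; exact hvx
        · rw [hpm]; exact hvz
    have hyT : ∀ s, (p s).val ≠ y := by
      intro s h
      rcases (p s).2 with h1 | h1 | h1
      · exact hxy.ne (h1.symm.trans h)
      · exact hyz.ne (h.symm.trans h1)
      · exact h1 (Or.inr (h ▸ hvy))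
    refine ⟨m + 2, fun t => if t = 0 then v else (p (t - 1)).val, y, by omega, ?_, ?_, ?_, ?_, ?_, ?_⟩
    · intro s t hs ht h
      by_cases h1 : s = 0 <;> by_cases h2 : t = 0 <;> simp only [h1, h2, if_true, if_false] at h
      · omega
      · exact absurd h.symm (hvT _)
      · exact absurd h (hvT _)
      · have := pinj _ _ (by omega) (by omega) (Subtype.ext h)
        omega
    · intro s t hs ht
      by_cases h1 : s = 0 <;> by_cases h2 : t = 0 <;> simp only [h1, h2, if_true, if_false]
      · simp [CycAdj]
      · rw [hvadj _ (by omega)]; unfold CycAdj; omega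
      · rw [G.adj_comm, hvadj _ (by omega)]; unfold CycAdj; omega
      · have := padj (s - 1) (t - 1) (by omega) (by omega)
        rw [SimpleGraph.induce_adj] at this
        rw [this]; unfold CycAdj; omega
    · intro s hs
      by_cases h1 : s = 0 <;> simp only [h1, if_true, if_false]
      · exact hvy.ne'
      · exact (hyT _).symm
    · simpa using hvy.symm
    · simp [hp0, x', hxy.symm]
    · simp [hpm, z', hyz]
end
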